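/- arXiv:2505.01987 — 4 statements merged into one kernel-verified Lean document; each statement's English description precedes it below -/
import Mathlib

section
/- Let X_1, X_2, ... satisfy Assumption 1 with conditional mean μ and conditional variance σ². For any nonnegative predictable sequence (λ̃_i)_{i≥1} with λ̃_1 > 0, the probability that there exists t ≥ 1 with |μ − (Σ_{i≤t} λ̃_i X_i)/(Σ_{i≤t} λ̃_i)| > (log(2/δ) + σ² Σ_{i≤t} ψ_P(λ̃_i))/(Σ_{i≤t} λ̃_i) is at most δ. (Anytime-valid Bennett's inequality: the stated interval is a (1−δ)-confidence sequence for μ.) -/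
open MeasureTheory ProbabilityTheory Filter Finset

/-- `ψ_P(λ) := exp(λ) − λ − 1`. -/
noncomputable def psiP (l : ℝ) : ℝ := Real.exp l - l - 1


lemma bennett_pt (l y : ℝ) (hl : 0 ≤ l) (hy : |y| ≤ 1) :
    Real.exp (l * y) ≤ 1 + l * y + psiP l * y ^ 2 := by
  have hs : ∀ x : ℝ, HasSum (fun n : ℕ => x ^ (n + 2) / ((n + 2).factorial : ℝ))
      (Real.exp x - x - 1) := by
    intro x
    have h := NormedSpace.expSeries_div_hasSum_exp (𝔸 := ℝ) x
    rw [← Real.exp_eq_exp_ℝ, ← hasSum_nat_add_iff' 2] at h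
    have e : Real.exp x - ∑ i ∈ Finset.range 2, x ^ i / (i.factorial : ℝ) = Real.exp x - x - 1 := by
      simp [Finset.sum_range_succ]; ring
    rw [e] at h
    exact h
  have := hasSum_le (fun n => ?_) (hs (l * y)) ((hs l).mul_right (y ^ 2))
  · unfold psiP; linarith
  · have h1 : y ^ n ≤ 1 := (le_abs_self _).trans (by rw [abs_pow]; exact pow_le_one₀ (abs_nonneg _) hy)
    have : (l * y) ^ (n + 2) ≤ l ^ (n + 2) * y ^ 2 := by
      rw [mul_pow, pow_add y]
      gcongr
      nlinarith [sq_nonneg y]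
    rw [div_mul_eq_mul_div]
    gcongr

lemma psiP_nonneg (l : ℝ) : 0 ≤ psiP l := by
  unfold psiP; linarith [Real.add_one_le_exp l]

lemma integral_mul_condconst {Ω : Type*} {m m0 : MeasurableSpace Ω} (P : Measure Ω)
    [IsProbabilityMeasure P] (hm : m ≤ m0) (b Z : Ω → ℝ) (k K : ℝ)
    (hb : StronglyMeasurable[m] b) (hbK : ∀ ω, |b ω| ≤ K) (hZ : Integrable Z P)
    (hk : P[Z|m] =ᵐ[P] fun _ => k) :
    Integrable (fun ω => b ω * Z ω) P ∧ ∫ ω, b ω * Z ω ∂P = ∫ ω, b ω * k ∂P := by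
  have h := condExp_stronglyMeasurable_mul_of_bound hm hb hZ K (ae_of_all _ hbK)
  refine ⟨hZ.bdd_mul (c := K) (hb.mono hm).aestronglyMeasurable (ae_of_all _ hbK), ?_⟩
  have h2 : ∫ ω, (P[b * Z|m]) ω ∂P = ∫ ω, b ω * Z ω ∂P := integral_condExp hm
  rw [← h2]
  apply integral_congr_ae
  filter_upwards [h, hk] with ω h1 h2
  simp [h1, h2]

lemma bennett_step {Ω : Type*} {m m0 : MeasurableSpace Ω} (P : Measure Ω)
    [IsProbabilityMeasure P] (hm : m ≤ m0) (G l Y : Ω → ℝ) (σ2 : ℝ)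
    (hG : Measurable[m] G) (hG0 : ∀ ω, 0 ≤ G ω)
    (hl : Measurable[m] l) (hl0 : ∀ ω, 0 ≤ l ω)
    (hY : Measurable Y) (hY1 : ∀ᵐ ω ∂P, |Y ω| ≤ 1)
    (hmean : P[Y|m] =ᵐ[P] fun _ => 0)
    (hvar : P[(fun ω => (Y ω)^2)|m] =ᵐ[P] fun _ => σ2) :
    ∫⁻ ω, ENNReal.ofReal (G ω * Real.exp (l ω * Y ω - σ2 * psiP (l ω))) ∂P
      ≤ ∫⁻ ω, ENNReal.ofReal (G ω) ∂P := by
  have hYi : Integrable Y P :=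
    Integrable.of_bound (C := 1) hY.aestronglyMeasurable hY1
  have hY2i : Integrable (fun ω => (Y ω)^2) P := by
    refine Integrable.of_bound (C := 1) (hY.pow_const 2).aestronglyMeasurable ?_
    filter_upwards [hY1] with ω h
    rw [Real.norm_eq_abs, abs_pow]; exact pow_le_one₀ (abs_nonneg _) h
  have hσ : 0 ≤ σ2 := by
    have h1 : ∫ ω, (P[(fun ω => (Y ω)^2)|m]) ω ∂P = ∫ ω, (Y ω)^2 ∂P := integral_condExp hm
    rw [integral_congr_ae hvar] at h1
    simp at h1
    rw [h1]; exact integral_nonneg fun ω => sq_nonneg _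
  have hpsi : Measurable psiP := by unfold psiP; fun_prop
  set H : Ω → ℝ := fun ω => G ω * Real.exp (- (σ2 * psiP (l ω))) with hH
  have hHm : Measurable[m] H :=
    hG.mul (Real.measurable_exp.comp ((hpsi.comp hl).const_mul σ2).neg)
  have hH0 : ∀ ω, 0 ≤ H ω := fun ω => mul_nonneg (hG0 ω) (Real.exp_pos _).le
  let B : ℕ → Set Ω := fun n => {ω | H ω ≤ n ∧ l ω ≤ n}
  have hBm : ∀ n, MeasurableSet[m] (B n) := fun n =>
    (measurableSet_le hHm measurable_const).inter (measurableSet_le hl measurable_const)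
  have hBmono : Monotone B := by
    intro i j hij ω h
    have : (i : ℝ) ≤ j := by exact_mod_cast hij
    exact ⟨h.1.trans this, h.2.trans this⟩
  have hBU : ⋃ n, B n = Set.univ := by
    ext ω
    obtain ⟨n, hn⟩ := exists_nat_ge (max (H ω) (l ω))
    simp only [Set.mem_iUnion, Set.mem_univ, iff_true]
    exact ⟨n, (le_max_left _ _).trans hn, (le_max_right _ _).trans hn⟩
  rw [← setLIntegral_univ, ← hBU, setLIntegral_iUnion_of_directed _ hBmono.directed_le]
  refine iSup_le fun n => ?_
  -- truncated coefficients
  set a : Ω → ℝ := (B n).indicator H with ha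
  set b : Ω → ℝ := (B n).indicator (fun ω => H ω * l ω) with hb
  set c : Ω → ℝ := (B n).indicator (fun ω => H ω * psiP (l ω)) with hc
  have ham : Measurable[m] a := hHm.indicator (hBm n)
  have hbm : Measurable[m] b := (hHm.mul hl).indicator (hBm n)
  have hcm : Measurable[m] c := (hHm.mul (hpsi.comp hl)).indicator (hBm n)
  have hab : ∀ ω, |a ω| ≤ n := by
    intro ω
    by_cases h : ω ∈ B n
    · simp only [ha, Set.indicator_of_mem h]; rw [abs_of_nonneg (hH0 ω)]; exact h.1
    · simp [ha, Set.indicator_of_notMem h]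
  have hbb : ∀ ω, |b ω| ≤ n * n := by
    intro ω
    by_cases h : ω ∈ B n
    · simp only [hb, Set.indicator_of_mem h]; rw [abs_of_nonneg (mul_nonneg (hH0 ω) (hl0 ω))]
      exact mul_le_mul h.1 h.2 (hl0 ω) (Nat.cast_nonneg n)
    · simp only [hb, Set.indicator_of_notMem h]; simp; positivity
  have hcb : ∀ ω, |c ω| ≤ n * Real.exp n := by
    intro ω
    by_cases h : ω ∈ B n
    · simp only [hc, Set.indicator_of_mem h]
      rw [abs_of_nonneg (mul_nonneg (hH0 ω) (psiP_nonneg _))]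
      refine mul_le_mul h.1 ?_ (psiP_nonneg _) (Nat.cast_nonneg n)
      have := Real.exp_le_exp.2 h.2
      have := hl0 ω
      unfold psiP; linarith
    · simp only [hc, Set.indicator_of_notMem h]; simp; positivity
  have hai : Integrable a P :=
    Integrable.of_bound (C := n) (ham.mono hm le_rfl).aestronglyMeasurable (ae_of_all _ hab)
  have hci : Integrable c P :=
    Integrable.of_bound (C := n * Real.exp n) (hcm.mono hm le_rfl).aestronglyMeasurable
      (ae_of_all _ hcb)
  obtain ⟨hbYi, hbY⟩ := integral_mul_condconst P hm b Y 0 _ hbm.stronglyMeasurable hbb hYi hmean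
  obtain ⟨hcYi, hcY⟩ := integral_mul_condconst P hm c _ σ2 _ hcm.stronglyMeasurable hcb hY2i hvar
  have habi : Integrable (fun ω => a ω + b ω * Y ω) P := hai.add hbYi
  have habci : Integrable (fun ω => a ω + b ω * Y ω + c ω * (Y ω)^2) P := habi.add hcYi
  have haci : Integrable (fun ω => a ω + c ω * σ2) P := hai.add (hci.mul_const _)
  have hI : ∫ ω, (a ω + b ω * Y ω + c ω * (Y ω)^2) ∂P = ∫ ω, (a ω + c ω * σ2) ∂P := by
    rw [integral_add habi hcYi, integral_add hai hbYi,
      integral_add hai (hci.mul_const _), hbY, hcY]; simp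
  have hpt : ∀ᵐ ω ∂P, (B n).indicator
      (fun ω => G ω * Real.exp (l ω * Y ω - σ2 * psiP (l ω))) ω
      ≤ a ω + b ω * Y ω + c ω * (Y ω)^2 := by
    filter_upwards [hY1] with ω hy
    by_cases h : ω ∈ B n
    · simp only [ha, hb, hc, Set.indicator_of_mem h]
      have := mul_le_mul_of_nonneg_left (bennett_pt _ _ (hl0 ω) hy) (hH0 ω)
      have e : G ω * Real.exp (l ω * Y ω - σ2 * psiP (l ω)) = H ω * Real.exp (l ω * Y ω) := by
        simp only [hH]; rw [mul_assoc, ← Real.exp_add]; congr 2; ring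
      rw [e]; linarith
    · simp [ha, hb, hc, Set.indicator_of_notMem h]
  have hBm0 : MeasurableSet (B n) := hm _ (hBm n)
  calc ∫⁻ ω in B n, ENNReal.ofReal (G ω * Real.exp (l ω * Y ω - σ2 * psiP (l ω))) ∂P
      = ∫⁻ ω, ENNReal.ofReal ((B n).indicator
          (fun ω => G ω * Real.exp (l ω * Y ω - σ2 * psiP (l ω))) ω) ∂P := by
        rw [← lintegral_indicator hBm0]
        congr 1; ext ω
        by_cases h : ω ∈ B n <;> simp [h]
    _ ≤ ∫⁻ ω, ENNReal.ofReal (a ω + b ω * Y ω + c ω * (Y ω)^2) ∂P := by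
        apply lintegral_mono_ae
        filter_upwards [hpt] with ω h using ENNReal.ofReal_le_ofReal h
    _ = ENNReal.ofReal (∫ ω, (a ω + c ω * σ2) ∂P) := by
        rw [← hI, ofReal_integral_eq_lintegral_ofReal habci]
        filter_upwards [hpt] with ω h
        refine le_trans ?_ h
        exact Set.indicator_nonneg (fun ω _ => mul_nonneg (hG0 ω) (Real.exp_pos _).le) ω
    _ = ∫⁻ ω, ENNReal.ofReal (a ω + c ω * σ2) ∂P := by
        rw [ofReal_integral_eq_lintegral_ofReal haci]
        refine ae_of_all _ fun ω => ?_
        exact add_nonneg (Set.indicator_nonneg (fun ω _ => hH0 ω) ω)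
          (mul_nonneg (Set.indicator_nonneg (fun ω _ => mul_nonneg (hH0 ω) (psiP_nonneg _)) ω) hσ)
    _ ≤ ∫⁻ ω, ENNReal.ofReal (G ω) ∂P := by
        apply lintegral_mono
        intro ω
        apply ENNReal.ofReal_le_ofReal
        by_cases h : ω ∈ B n
        · simp only [ha, hc, Set.indicator_of_mem h]
          have e1 := Real.add_one_le_exp (σ2 * psiP (l ω))
          have e2 : G ω = H ω * Real.exp (σ2 * psiP (l ω)) := by
            simp only [hH]; rw [mul_assoc, ← Real.exp_add]; simp
          rw [e2]
          nlinarith [mul_le_mul_of_nonneg_left e1 (hH0 ω)]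
        · simp [ha, hc, Set.indicator_of_notMem h, hG0 ω]

/-- Stopped exponential process. -/
noncomputable def frozenProc {Ω : Type*} (y l : ℕ → Ω → ℝ) (σ2 c : ℝ) : ℕ → Ω → ℝ
  | 0 => fun _ => 1
  | n + 1 => fun ω => frozenProc y l σ2 c n ω *
      Real.exp ((if c < frozenProc y l σ2 c n ω then 0 else l n ω) * y n ω
        - σ2 * psiP (if c < frozenProc y l σ2 c n ω then 0 else l n ω))

lemma psiP_zero : psiP 0 = 0 := by simp [psiP]

lemma ville_bennett {Ω : Type*} {m0 : MeasurableSpace Ω} (P : Measure Ω)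
    [IsProbabilityMeasure P] (ℱ : Filtration ℕ m0) (y l : ℕ → Ω → ℝ) (σ2 c : ℝ) (hc : 0 < c)
    (hl : ∀ n, Measurable[ℱ n] (l n)) (hl0 : ∀ n ω, 0 ≤ l n ω)
    (hY : ∀ n, Measurable[ℱ (n + 1)] (y n)) (hY1 : ∀ n, ∀ᵐ ω ∂P, |y n ω| ≤ 1)
    (hmean : ∀ n, P[y n|ℱ n] =ᵐ[P] fun _ => 0)
    (hvar : ∀ n, P[(fun ω => (y n ω)^2)|ℱ n] =ᵐ[P] fun _ => σ2) :
    P {ω | ∃ t, c < Real.exp (∑ i ∈ Finset.range t, (l i ω * y i ω - σ2 * psiP (l i ω)))}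
      ≤ ENNReal.ofReal (1 / c) := by
  have hpsi : Measurable psiP := by unfold psiP; fun_prop
  set S := frozenProc y l σ2 c with hS
  have hSm : ∀ n, Measurable[ℱ n] (S n) ∧
      Measurable[ℱ n] (fun ω => if c < S n ω then 0 else l n ω) := by
    have aux : ∀ n, Measurable[ℱ n] (S n) →
        Measurable[ℱ n] (fun ω => if c < S n ω then 0 else l n ω) := fun n h =>
      Measurable.ite (measurableSet_lt measurable_const h) measurable_const (hl n)
    intro n
    induction n with
    | zero => exact ⟨measurable_const, aux 0 measurable_const⟩
    | succ n ih =>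
      have : Measurable[ℱ (n + 1)] (S (n + 1)) := by
        have h1 := ih.1.mono (ℱ.mono (Nat.le_succ n)) le_rfl
        have h2 := ih.2.mono (ℱ.mono (Nat.le_succ n)) le_rfl
        exact h1.mul (Real.measurable_exp.comp
          ((h2.mul (hY n)).sub ((hpsi.comp h2).const_mul σ2)))
      exact ⟨this, aux _ this⟩
  have hS0 : ∀ n ω, 0 ≤ S n ω := by
    intro n ω
    induction n with
    | zero => exact zero_le_one
    | succ n ih => exact mul_nonneg ih (Real.exp_pos _).le
  have hSI : ∀ n, ∫⁻ ω, ENNReal.ofReal (S n ω) ∂P ≤ 1 := by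
    intro n
    induction n with
    | zero => simp [hS, frozenProc]
    | succ n ih =>
      refine le_trans ?_ ih
      exact bennett_step P (ℱ.le n) (S n) _ (y n) σ2 (hSm n).1 (hS0 n) (hSm n).2
        (fun ω => by split_ifs <;> simp [hl0 n ω]) ((hY n).mono (ℱ.le _) le_rfl) (hY1 n)
        (hmean n) (hvar n)
  have hstay : ∀ n ω, c < S n ω → S (n + 1) ω = S n ω := by
    intro n ω h
    have : S (n + 1) ω = S n ω *
      Real.exp ((if c < S n ω then 0 else l n ω) * y n ω
        - σ2 * psiP (if c < S n ω then 0 else l n ω)) := rfl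
    rw [this]; simp [h, psiP_zero]
  have hmono : Monotone (fun n => {ω | c < S n ω}) := by
    refine monotone_nat_of_le_succ fun n ω h => ?_
    simp only [Set.mem_ofPred_eq] at h ⊢
    rw [hstay n ω h]; exact h
  have hkey : ∀ n ω, c < S n ω ∨
      S n ω = Real.exp (∑ i ∈ Finset.range n, (l i ω * y i ω - σ2 * psiP (l i ω))) := by
    intro n ω
    induction n with
    | zero => right; simp [hS, frozenProc]
    | succ n ih =>
      by_cases h : c < S n ω
      · left; rw [hstay n ω h]; exact h
      · right
        have e : S (n + 1) ω = S n ω *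
          Real.exp ((if c < S n ω then 0 else l n ω) * y n ω
            - σ2 * psiP (if c < S n ω then 0 else l n ω)) := rfl
        rw [e, ih.resolve_left h, if_neg (by rw [← ih.resolve_left h]; exact h),
          Finset.sum_range_succ, Real.exp_add]
  calc _ ≤ P (⋃ n, {ω | c < S n ω}) := by
        apply measure_mono
        rintro ω ⟨t, ht⟩
        refine Set.mem_iUnion.2 ⟨t, ?_⟩
        rcases hkey t ω with h | h
        · exact h
        · simpa [h] using ht
    _ = ⨆ n, P {ω | c < S n ω} := hmono.measure_iUnion
    _ ≤ _ := by
        refine iSup_le fun n => ?_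
        have hmeas : Measurable (fun ω => ENNReal.ofReal (S n ω)) :=
          ((hSm n).1.mono (ℱ.le n) le_rfl).ennreal_ofReal
        have := meas_ge_le_lintegral_div (μ := P) hmeas.aemeasurable
          (ε := ENNReal.ofReal c) (by simpa using hc) ENNReal.ofReal_ne_top
        calc P {ω | c < S n ω} ≤ P {ω | ENNReal.ofReal c ≤ ENNReal.ofReal (S n ω)} :=
              measure_mono fun ω h => ENNReal.ofReal_le_ofReal (le_of_lt h)
          _ ≤ _ := this
          _ ≤ 1 / ENNReal.ofReal c := by gcongr; exact hSI n
          _ = _ := by rw [ENNReal.ofReal_div_of_pos hc]; simp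

/-- Anytime-valid Bennett's inequality (Theorem 3 of the paper). -/
theorem anytime_valid_bennett
    {Ω : Type*} {m0 : MeasurableSpace Ω} (P : Measure Ω) [IsProbabilityMeasure P]
    (ℱ : Filtration ℕ m0) (X lam : ℕ → Ω → ℝ) (μ σ2 δ : ℝ)
    (hδ : δ ∈ Set.Ioo (0:ℝ) 1)
    (hadapt : Adapted ℱ X)
    (hint : ∀ t, 1 ≤ t → Integrable (X t) P)
    (hbdd : ∀ t, 1 ≤ t → ∀ᵐ ω ∂P, X t ω ∈ Set.Icc (0:ℝ) 1)
    (hmean : ∀ t, 1 ≤ t → P[X t|ℱ (t - 1)] =ᵐ[P] fun _ => μ)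
    (hvar : ∀ t, 1 ≤ t → P[(fun ω => (X t ω - μ)^2)|ℱ (t - 1)] =ᵐ[P] fun _ => σ2)
    (hpred : ∀ t, 1 ≤ t → StronglyMeasurable[ℱ (t - 1)] (lam t))
    (hnonneg : ∀ t, 1 ≤ t → ∀ ω, 0 ≤ lam t ω)
    (hpos : ∀ ω, 0 < lam 1 ω) :
    P {ω | ∃ t, 1 ≤ t ∧
        (Real.log (2/δ) + σ2 * ∑ i ∈ Finset.Icc 1 t, psiP (lam i ω)) /
            (∑ i ∈ Finset.Icc 1 t, lam i ω)
          < |μ - (∑ i ∈ Finset.Icc 1 t, lam i ω * X i ω) /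
              (∑ i ∈ Finset.Icc 1 t, lam i ω)|}
      ≤ ENNReal.ofReal δ := by
  have hδ0 : 0 < δ := hδ.1
  have hμ : μ ∈ Set.Icc (0:ℝ) 1 := by
    have h1 : ∫ ω, (P[X 1|ℱ (1 - 1)]) ω ∂P = ∫ ω, X 1 ω ∂P := integral_condExp (ℱ.le _)
    rw [integral_congr_ae (hmean 1 le_rfl)] at h1
    simp at h1
    constructor
    · rw [h1]; apply integral_nonneg_of_ae
      filter_upwards [hbdd 1 le_rfl] with ω h using h.1
    · rw [h1]
      have : ∫ ω, X 1 ω ∂P ≤ ∫ ω, (1:ℝ) ∂P := by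
        apply integral_mono_ae (hint 1 le_rfl) (integrable_const _)
        filter_upwards [hbdd 1 le_rfl] with ω h using h.2
      simpa using this
  have hXm : ∀ n, Measurable[ℱ (n + 1)] (fun ω => X (n + 1) ω - μ) :=
    fun n => (hadapt (n + 1)).sub_const μ
  have hb1 : ∀ n, ∀ᵐ ω ∂P, |X (n + 1) ω - μ| ≤ 1 := fun n => by
    filter_upwards [hbdd (n + 1) (by omega)] with ω h
    rw [abs_le]; constructor <;> linarith [h.1, h.2, hμ.1, hμ.2]
  have hm1 : ∀ n, P[(fun ω => X (n + 1) ω - μ)|ℱ n] =ᵐ[P] fun _ => 0 := fun n => by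
    have h1 := condExp_sub (hint (n + 1) (by omega)) (integrable_const μ) (ℱ n)
    have h2 := hmean (n + 1) (by omega)
    rw [condExp_const (ℱ.le n)] at h1
    filter_upwards [h1, h2] with ω h1 h2
    refine h1.trans ?_
    simp only [Nat.add_sub_cancel] at h2
    simp [h2]
  have hm2 : ∀ n, P[(fun ω => -(X (n + 1) ω - μ))|ℱ n] =ᵐ[P] fun _ => 0 := fun n => by
    have h1 := condExp_neg (μ := P) (fun ω => X (n + 1) ω - μ) (ℱ n)
    filter_upwards [h1, hm1 n] with ω h1 h2
    refine h1.trans ?_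
    simp [h2]
  have hv : ∀ n, P[(fun ω => (X (n + 1) ω - μ)^2)|ℱ n] =ᵐ[P] fun _ => σ2 :=
    fun n => hvar (n + 1) (by omega)
  have hlm : ∀ n, Measurable[ℱ n] (lam (n + 1)) := fun n => (hpred (n + 1) (by omega)).measurable
  have hl0 : ∀ n ω, 0 ≤ lam (n + 1) ω := fun n => hnonneg (n + 1) (by omega)
  have hc : 0 < 2 / δ := by positivity
  have A1 := ville_bennett P ℱ (fun n ω => X (n + 1) ω - μ) (fun n => lam (n + 1)) σ2 (2 / δ) hc
    hlm hl0 hXm hb1 hm1 hv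
  have A2 := ville_bennett P ℱ (fun n ω => -(X (n + 1) ω - μ)) (fun n => lam (n + 1)) σ2 (2 / δ) hc
    hlm hl0 (fun n => (hXm n).neg) (by simpa only [abs_neg] using hb1) hm2
    (by simpa only [neg_sq] using hv)
  have hfin : ENNReal.ofReal (1 / (2 / δ)) + ENNReal.ofReal (1 / (2 / δ)) = ENNReal.ofReal δ := by
    rw [← ENNReal.ofReal_add (by positivity) (by positivity)]
    congr 1; field_simp; ring
  rw [← hfin]
  refine le_trans ((measure_mono ?_).trans (measure_union_le _ _)) (add_le_add A1 A2)
  rintro ω ⟨t, ht, h⟩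
  have hre : ∀ f : ℕ → ℝ, ∑ i ∈ Finset.Icc 1 t, f i = ∑ i ∈ Finset.range t, f (i + 1) := by
    intro f
    clear * -
    induction t with
    | zero => simp
    | succ n ih => rw [Finset.sum_Icc_succ_top (by omega), ih, Finset.sum_range_succ]
  have hL : 0 < ∑ i ∈ Finset.Icc 1 t, lam i ω := by
    refine lt_of_lt_of_le (hpos ω) (Finset.single_le_sum (f := fun i => lam i ω) ?_ ?_)
    · intro i hi; exact hnonneg i (Finset.mem_Icc.1 hi).1 ω
    · simp [ht]
  set L := ∑ i ∈ Finset.Icc 1 t, lam i ω with hLdef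
  set XS := ∑ i ∈ Finset.Icc 1 t, lam i ω * X i ω with hXS
  set Q := ∑ i ∈ Finset.Icc 1 t, psiP (lam i ω) with hQ
  have e : μ - XS / L = (μ * L - XS) / L := by field_simp
  rw [e, abs_div, abs_of_pos hL, div_lt_div_iff_of_pos_right hL] at h
  rcases lt_abs.1 h with h | h
  · right
    refine ⟨t, ?_⟩
    rw [← Real.log_lt_iff_lt_exp hc]
    have : ∑ i ∈ Finset.range t, (lam (i + 1) ω * -(X (i + 1) ω - μ) - σ2 * psiP (lam (i + 1) ω))
        = μ * L - XS - σ2 * Q := by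
      rw [← hre (fun i => lam i ω * -(X i ω - μ) - σ2 * psiP (lam i ω)), hLdef, hXS, hQ,
        Finset.mul_sum, Finset.mul_sum, ← Finset.sum_sub_distrib, ← Finset.sum_sub_distrib]
      exact Finset.sum_congr rfl fun i _ => by ring
    rw [this]; linarith
  · left
    refine ⟨t, ?_⟩
    rw [← Real.log_lt_iff_lt_exp hc]
    have : ∑ i ∈ Finset.range t, (lam (i + 1) ω * (X (i + 1) ω - μ) - σ2 * psiP (lam (i + 1) ω))
        = -(μ * L - XS) - σ2 * Q := by
      rw [← hre (fun i => lam i ω * (X i ω - μ) - σ2 * psiP (lam i ω)), hLdef, hXS, hQ,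
        Finset.mul_sum, Finset.mul_sum, ← Finset.sum_sub_distrib, ← Finset.sum_neg_distrib,
        ← Finset.sum_sub_distrib]
      exact Finset.sum_congr rfl fun i _ => by ring
    rw [this]; linarith
end

section
/- Let X_1, X_2, ... satisfy Assumption 1 with conditional mean μ and conditional variance σ². For any [0,1]-valued predictable sequence (μ̂_i)_{i≥1}, set σ̃_i² := σ² + (μ̂_i − μ)². Then for any [0,1]-valued predictable sequence (σ̂_i)_{i≥1} and any [0,1)-valued predictable sequence (λ_i)_{i≥1}, the process S_t^+ defined by S_0^+ := 1 and S_t^+ := exp{ Σ_{i≤t} [ λ_i((X_i − μ̂_i)² − σ̃_i²) − ψ_E(λ_i)((X_i − μ̂_i)² − σ̂_i²)² ] } for t ≥ 1 is a nonnegative supermartingale with respect to (F_t). -/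
open MeasureTheory ProbabilityTheory Filter Finset

/-- `ψ_E(λ) := −log(1−λ) − λ`. -/
noncomputable def psiE (l : ℝ) : ℝ := -Real.log (1 - l) - l

lemma psiE_nonneg {l : ℝ} (h1 : l < 1) : 0 ≤ psiE l := by
  unfold psiE
  have := Real.log_le_sub_one_of_pos (show 0 < 1 - l by linarith)
  linarith

lemma fan_log {x l : ℝ} (hx : -1 ≤ x) (h0 : 0 ≤ l) (h1 : l < 1) :
    l * x - psiE l * x ^ 2 ≤ Real.log (1 + l * x) := by
  have pos : ∀ y ∈ Set.Ico (0:ℝ) 1, 0 < 1 + y * x := by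
    intro y hy
    nlinarith [hy.1, hy.2, mul_nonneg hy.1 (show 0 ≤ x + 1 by linarith)]
  have hd : ∀ y ∈ Set.Ico (0:ℝ) 1, HasDerivAt
      (fun y => Real.log (1 + y * x) - y * x + (-Real.log (1 - y) - y) * x ^ 2)
      (x / (1 + y * x) - x + (1 / (1 - y) - 1) * x ^ 2) y := by
    intro y hy
    have e1 : HasDerivAt (fun y : ℝ => y * x) x y := by
      simpa using (hasDerivAt_id y).mul_const x
    have e2 := (e1.const_add 1).log (pos y hy).ne'
    have e3 := ((hasDerivAt_id y).const_sub 1).log (by have := hy.2; simp only [id]; linarith)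
    have e4 := ((e3.neg.sub (hasDerivAt_id y)).mul_const (x ^ 2))
    have := (e2.sub e1).add e4
    refine this.congr_deriv ?_
    simp only [id]
    ring
  have mono : MonotoneOn
      (fun y => Real.log (1 + y * x) - y * x + (-Real.log (1 - y) - y) * x ^ 2)
      (Set.Ico (0:ℝ) 1) := by
    apply monotoneOn_of_deriv_nonneg (convex_Ico 0 1)
    · intro y hy
      exact (hd y hy).continuousAt.continuousWithinAt
    · intro y hy
      exact (hd y (interior_subset hy)).differentiableAt.differentiableWithinAt
    · intro y hy
      have hy' := interior_subset hy
      rw [(hd y hy').deriv]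
      have p1 := pos y hy'
      have p2 : 0 < 1 - y := by linarith [hy'.2]
      have : x / (1 + y * x) - x + (1 / (1 - y) - 1) * x ^ 2
          = x ^ 2 * (y * (y * (1 + x))) / ((1 + y * x) * (1 - y)) := by
        have q1 : 1 + y * x ≠ 0 := p1.ne'
        have q1' : 1 + x * y ≠ 0 := by rwa [mul_comm x y]
        have q2 : 1 - y ≠ 0 := p2.ne'
        field_simp
        ring
      rw [this]
      have := hy'.1
      have : 0 ≤ 1 + x := by linarith
      positivity
  have := mono (show (0:ℝ) ∈ Set.Ico (0:ℝ) 1 by simp) ⟨h0, h1⟩ h0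
  simp at this
  unfold psiE
  linarith

lemma fan_exp {x l : ℝ} (hx : -1 ≤ x) (h0 : 0 ≤ l) (h1 : l < 1) :
    Real.exp (l * x - psiE l * x ^ 2) ≤ 1 + l * x := by
  have p : 0 < 1 + l * x := by
    nlinarith [mul_nonneg h0 (show 0 ≤ x + 1 by linarith)]
  rw [← Real.le_log_iff_exp_le p]
  exact fan_log hx h0 h1

lemma step_aux {Ω : Type*} {m m0 : MeasurableSpace Ω} (P : Measure Ω) [IsProbabilityMeasure P]
    (hm : m ≤ m0) (x h s l w : Ω → ℝ) (μ σ2 : ℝ)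
    (hxm : Measurable x) (hxi : Integrable x P)
    (hx : ∀ᵐ ω ∂P, x ω ∈ Set.Icc (0:ℝ) 1)
    (hmean : P[x|m] =ᵐ[P] fun _ => μ)
    (hvar : P[(fun ω => (x ω - μ)^2)|m] =ᵐ[P] fun _ => σ2)
    (hhm : Measurable[m] h) (hh : ∀ ω, h ω ∈ Set.Icc (0:ℝ) 1)
    (hsm : Measurable[m] s) (hs : ∀ ω, s ω ∈ Set.Icc (0:ℝ) 1)
    (hlm : Measurable[m] l) (hl : ∀ ω, l ω ∈ Set.Ico (0:ℝ) 1)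
    (hwm : Measurable[m] w) (hwi : Integrable w P) (hw : ∀ ω, 0 ≤ w ω) :
    Integrable (fun ω => w ω * Real.exp (l ω * ((x ω - h ω)^2 - (σ2 + (h ω - μ)^2))
          - psiE (l ω) * ((x ω - h ω)^2 - (s ω)^2)^2)) P ∧
    P[(fun ω => w ω * Real.exp (l ω * ((x ω - h ω)^2 - (σ2 + (h ω - μ)^2))
          - psiE (l ω) * ((x ω - h ω)^2 - (s ω)^2)^2))|m] ≤ᵐ[P] w := by
  have hh0 : Measurable h := hhm.mono hm le_rfl
  have hs0 : Measurable s := hsm.mono hm le_rfl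
  have hl0 : Measurable l := hlm.mono hm le_rfl
  have hI : Integrable (fun ω => w ω * Real.exp (l ω * ((x ω - h ω)^2 - (σ2 + (h ω - μ)^2))
          - psiE (l ω) * ((x ω - h ω)^2 - (s ω)^2)^2)) P := by
    refine hwi.mul_bdd (c := Real.exp (1 + |σ2|)) ?_ ?_
    · apply Measurable.aestronglyMeasurable
      unfold psiE
      fun_prop
    · filter_upwards [hx] with ω hxω
      rw [Real.norm_eq_abs, abs_of_pos (Real.exp_pos _), Real.exp_le_exp]
      have a1 := mul_nonneg (psiE_nonneg (hl ω).2) (sq_nonneg ((x ω - h ω)^2 - (s ω)^2))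
      have a2 : (x ω - h ω)^2 ≤ 1 := by
        rw [sq_le_one_iff_abs_le_one, abs_le]
        constructor <;> linarith [hxω.1, hxω.2, (hh ω).1, (hh ω).2]
      have a3 : (x ω - h ω)^2 - (σ2 + (h ω - μ)^2) ≤ 1 + |σ2| := by
        have := neg_abs_le σ2
        nlinarith [sq_nonneg (h ω - μ)]
      have a4 := mul_le_mul_of_nonneg_left a3 (hl ω).1
      have a5 : l ω * (1 + |σ2|) ≤ 1 * (1 + |σ2|) :=
        mul_le_mul_of_nonneg_right (hl ω).2.le (by positivity)
      linarith
  refine ⟨hI, ?_⟩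
  set g : Ω → ℝ := fun ω => w ω * Real.exp (l ω * ((s ω)^2 - (σ2 + (h ω - μ)^2))) with hg
  have hgm : Measurable[m] g := by
    rw [hg]; fun_prop
  have hgi : Integrable g P := by
    refine hwi.mul_bdd (c := Real.exp (1 + |σ2|)) ?_ ?_
    · apply Measurable.aestronglyMeasurable
      fun_prop
    · refine Eventually.of_forall fun ω => ?_
      rw [Real.norm_eq_abs, abs_of_pos (Real.exp_pos _), Real.exp_le_exp]
      have a2 : (s ω)^2 ≤ 1 := by
        nlinarith [(hs ω).1, (hs ω).2]
      have a3 : (s ω)^2 - (σ2 + (h ω - μ)^2) ≤ 1 + |σ2| := by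
        have := neg_abs_le σ2
        nlinarith [sq_nonneg (h ω - μ)]
      have a4 := mul_le_mul_of_nonneg_left a3 (hl ω).1
      have a5 : l ω * (1 + |σ2|) ≤ 1 * (1 + |σ2|) :=
        mul_le_mul_of_nonneg_right (hl ω).2.le (by positivity)
      linarith
  -- predictable coefficients
  set A : Ω → ℝ := fun ω => g ω * (1 + l ω * ((h ω - μ)^2 - (s ω)^2)) with hA
  set B : Ω → ℝ := fun ω => g ω * l ω with hB
  set C : Ω → ℝ := fun ω => g ω * (l ω * (2 * (μ - h ω))) with hC
  set D : Ω → ℝ := fun ω => x ω - μ with hD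
  set D2 : Ω → ℝ := fun ω => (x ω - μ)^2 with hD2
  have hAm : Measurable[m] A := by rw [hA]; fun_prop
  have hBm : Measurable[m] B := by rw [hB]; fun_prop
  have hCm : Measurable[m] C := by rw [hC]; fun_prop
  have absl : ∀ ω, |l ω| ≤ 1 := fun ω => abs_le.2 ⟨by linarith [(hl ω).1], (hl ω).2.le⟩
  have abshm : ∀ ω, |h ω - μ| ≤ 1 + |μ| := fun ω => (abs_sub _ _).trans
    (by gcongr; exact abs_le.2 ⟨by linarith [(hh ω).1], (hh ω).2⟩)
  have abss : ∀ ω, |s ω| ≤ 1 := fun ω => abs_le.2 ⟨by linarith [(hs ω).1], (hs ω).2⟩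
  have hAi : Integrable A P := by
    refine hgi.mul_bdd (c := 1 + 1 * ((1 + |μ|)^2 + 1^2)) ?_ ?_
    · apply Measurable.aestronglyMeasurable
      fun_prop
    · refine Eventually.of_forall fun ω => ?_
      rw [Real.norm_eq_abs]
      refine (abs_add_le _ _).trans ?_
      rw [abs_one, abs_mul]
      gcongr
      · exact absl ω
      · refine (abs_sub _ _).trans ?_
        rw [abs_pow, abs_pow]
        gcongr
        · exact abshm ω
        · exact abss ω
  have hBi : Integrable B P := by
    refine hgi.mul_bdd (c := 1) hl0.aestronglyMeasurable (Eventually.of_forall absl)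
  have hCi : Integrable C P := by
    refine hgi.mul_bdd (c := 1 * (2 * (1 + |μ|))) ?_ ?_
    · apply Measurable.aestronglyMeasurable
      fun_prop
    · refine Eventually.of_forall fun ω => ?_
      rw [Real.norm_eq_abs, abs_mul, abs_mul, abs_two, abs_sub_comm]
      gcongr
      · exact absl ω
      · exact abshm ω
  have absD : ∀ᵐ ω ∂P, |x ω - μ| ≤ 1 + |μ| := by
    filter_upwards [hx] with ω hxω
    exact (abs_sub _ _).trans
      (by gcongr; exact abs_le.2 ⟨by linarith [hxω.1], hxω.2⟩)
  have absD2 : ∀ᵐ ω ∂P, |(x ω - μ)^2| ≤ (1 + |μ|)^2 := by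
    filter_upwards [absD] with ω hω
    rw [abs_pow]
    gcongr
  have hDm : Measurable D := by rw [hD]; fun_prop
  have hD2m : Measurable D2 := by rw [hD2]; fun_prop
  have hDi : Integrable D P := Integrable.of_bound hDm.aestronglyMeasurable _ absD
  have hD2i : Integrable D2 P := Integrable.of_bound hD2m.aestronglyMeasurable _ absD2
  have hBD : Integrable (B * D2) P := hBi.mul_bdd hD2m.aestronglyMeasurable absD2
  have hCD : Integrable (C * D) P := hCi.mul_bdd hDm.aestronglyMeasurable absD
  have hDc : P[D|m] =ᵐ[P] fun _ => 0 := by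
    have h1 := condExp_sub hxi (integrable_const μ) m
    have h2 : P[fun _ : Ω => μ|m] = fun _ => μ := condExp_const hm μ
    rw [h2] at h1
    filter_upwards [h1, hmean] with ω e1 e2
    have e3 : (P[D|m]) ω = (P[x|m]) ω - μ := e1
    rw [e3, e2, sub_self]
  have hle : (fun ω => w ω * Real.exp (l ω * ((x ω - h ω)^2 - (σ2 + (h ω - μ)^2))
          - psiE (l ω) * ((x ω - h ω)^2 - (s ω)^2)^2)) ≤ᵐ[P] (A + B * D2) + C * D := by
    refine Eventually.of_forall fun ω => ?_
    have a1 : -1 ≤ (x ω - h ω)^2 - (s ω)^2 := by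
      nlinarith [(hs ω).1, (hs ω).2, sq_nonneg (x ω - h ω)]
    have a2 := fan_exp a1 (hl ω).1 (hl ω).2
    have a3 : l ω * ((x ω - h ω)^2 - (σ2 + (h ω - μ)^2))
          - psiE (l ω) * ((x ω - h ω)^2 - (s ω)^2)^2
        = l ω * ((s ω)^2 - (σ2 + (h ω - μ)^2)) + (l ω * ((x ω - h ω)^2 - (s ω)^2)
          - psiE (l ω) * ((x ω - h ω)^2 - (s ω)^2)^2) := by ring
    have a4 : ((A + B * D2) + C * D) ω = g ω * (1 + l ω * ((x ω - h ω)^2 - (s ω)^2)) := by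
      simp only [Pi.add_apply, Pi.mul_apply, hA, hB, hC, hD, hD2]
      ring
    rw [a4]
    simp only
    rw [a3, Real.exp_add, ← mul_assoc]
    exact mul_le_mul_of_nonneg_left a2 (mul_nonneg (hw ω) (Real.exp_pos _).le)
  have c1 := condExp_mono (m := m) hI ((hAi.add hBD).add hCD) hle
  have c2 := condExp_add (hAi.add hBD) hCD m
  have c3 := condExp_add hAi hBD m
  have c4 : P[A|m] = A := condExp_of_stronglyMeasurable hm hAm.stronglyMeasurable hAi
  have c5 := condExp_mul_of_stronglyMeasurable_left hBm.stronglyMeasurable hBD hD2i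
  have c6 := condExp_mul_of_stronglyMeasurable_left hCm.stronglyMeasurable hCD hDi
  filter_upwards [c1, c2, c3, c5, c6, hDc, hvar] with ω d1 d2 d3 d5 d6 d7 d8
  refine d1.trans ?_
  rw [d2, Pi.add_apply, d3, Pi.add_apply, c4, d5, d6, Pi.mul_apply, Pi.mul_apply, d7, d8]
  simp only [hA, hB, hg]
  have b1 := Real.add_one_le_exp (-(l ω * ((s ω)^2 - (σ2 + (h ω - μ)^2))))
  have b2 := mul_le_mul_of_nonneg_left b1
    (mul_nonneg (hw ω) (Real.exp_pos (l ω * ((s ω)^2 - (σ2 + (h ω - μ)^2)))).le)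
  rw [mul_assoc (w ω) _ (Real.exp _), ← Real.exp_add, add_neg_cancel, Real.exp_zero, mul_one] at b2
  refine le_trans (le_of_eq ?_) b2
  ring

/-- Theorem 4 of the paper, the `S⁺` process: a nonnegative supermartingale. -/
theorem supermartingale_plus
    {Ω : Type*} {m0 : MeasurableSpace Ω} (P : Measure Ω) [IsProbabilityMeasure P]
    (ℱ : Filtration ℕ m0) (X muhat sighat lam : ℕ → Ω → ℝ) (μ σ2 : ℝ)
    (hadapt : Adapted ℱ X)
    (hint : ∀ t, 1 ≤ t → Integrable (X t) P)
    (hbdd : ∀ t, 1 ≤ t → ∀ᵐ ω ∂P, X t ω ∈ Set.Icc (0:ℝ) 1)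
    (hmean : ∀ t, 1 ≤ t → P[X t|ℱ (t - 1)] =ᵐ[P] fun _ => μ)
    (hvar : ∀ t, 1 ≤ t → P[(fun ω => (X t ω - μ)^2)|ℱ (t - 1)] =ᵐ[P] fun _ => σ2)
    (hmu_pred : ∀ t, 1 ≤ t → StronglyMeasurable[ℱ (t - 1)] (muhat t))
    (hmu_mem : ∀ t, 1 ≤ t → ∀ ω, muhat t ω ∈ Set.Icc (0:ℝ) 1)
    (hsig_pred : ∀ t, 1 ≤ t → StronglyMeasurable[ℱ (t - 1)] (sighat t))
    (hsig_mem : ∀ t, 1 ≤ t → ∀ ω, sighat t ω ∈ Set.Icc (0:ℝ) 1)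
    (hlam_pred : ∀ t, 1 ≤ t → StronglyMeasurable[ℱ (t - 1)] (lam t))
    (hlam_mem : ∀ t, 1 ≤ t → ∀ ω, lam t ω ∈ Set.Ico (0:ℝ) 1)
    (S : ℕ → Ω → ℝ)
    (hS : S = fun t ω => Real.exp (∑ i ∈ Finset.Icc 1 t,
        (lam i ω * ((X i ω - muhat i ω)^2 - (σ2 + (muhat i ω - μ)^2))
          - psiE (lam i ω) * ((X i ω - muhat i ω)^2 - (sighat i ω)^2)^2))) :
    (∀ t ω, 0 ≤ S t ω) ∧ Supermartingale S ℱ P := by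
  have hS0 : ∀ t ω, 0 ≤ S t ω := by
    intro t ω
    rw [hS]
    exact (Real.exp_pos _).le
  have hSm : ∀ t, Measurable[ℱ t] (S t) := by
    intro t
    rw [hS]
    refine Real.measurable_exp.comp (Finset.measurable_fun_sum _ ?_)
    intro i hi
    obtain ⟨h1, h2⟩ := Finset.mem_Icc.1 hi
    have k1 : Measurable[ℱ t] (X i) := (hadapt i).mono (ℱ.mono h2) le_rfl
    have h3 : ℱ (i - 1) ≤ ℱ t := ℱ.mono (by omega)
    have k2 : Measurable[ℱ t] (muhat i) := (hmu_pred i h1).measurable.mono h3 le_rfl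
    have k3 : Measurable[ℱ t] (sighat i) := (hsig_pred i h1).measurable.mono h3 le_rfl
    have k4 : Measurable[ℱ t] (lam i) := (hlam_pred i h1).measurable.mono h3 le_rfl
    unfold psiE
    fun_prop
  have hsucc : ∀ t, S (t + 1) = fun ω => S t ω * Real.exp
      (lam (t+1) ω * ((X (t+1) ω - muhat (t+1) ω)^2 - (σ2 + (muhat (t+1) ω - μ)^2))
          - psiE (lam (t+1) ω) * ((X (t+1) ω - muhat (t+1) ω)^2 - (sighat (t+1) ω)^2)^2) := by
    intro t
    rw [hS]
    funext ω
    simp only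
    rw [Finset.sum_Icc_succ_top (by omega), Real.exp_add]
  have key := fun t (hi : Integrable (S t) P) =>
    step_aux P (ℱ.le t) (X (t+1)) (muhat (t+1)) (sighat (t+1)) (lam (t+1)) (S t) μ σ2
      ((hadapt (t+1)).mono (ℱ.le _) le_rfl) (hint _ (by omega)) (hbdd _ (by omega))
      (hmean (t+1) (by omega)) (hvar (t+1) (by omega))
      (hmu_pred (t+1) (by omega)).measurable (hmu_mem _ (by omega))
      (hsig_pred (t+1) (by omega)).measurable (hsig_mem _ (by omega))
      (hlam_pred (t+1) (by omega)).measurable (hlam_mem _ (by omega))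
      (hSm t) hi (hS0 t)
  have hSi : ∀ t, Integrable (S t) P := by
    intro t
    induction t with
    | zero => rw [hS]; simp
    | succ t ih => rw [hsucc]; exact (key t ih).1
  refine ⟨hS0, supermartingale_nat (fun t => (hSm t).stronglyMeasurable) hSi fun t => ?_⟩
  rw [hsucc]
  exact (key t (hSi t)).2
end

section
/- Let X_1, X_2, ... satisfy Assumption 1 with conditional mean μ and conditional variance σ². For any [0,1]-valued predictable sequence (μ̂_i)_{i≥1}, set σ̃_i² := σ² + (μ̂_i − μ)². Then for any [0,1]-valued predictable sequence (σ̂_i)_{i≥1} and any [0,1)-valued predictable sequence (λ_i)_{i≥1}, the process S_t^− defined by S_0^− := 1 and S_t^− := exp{ Σ_{i≤t} [ λ_i(σ̃_i² − (X_i − μ̂_i)²) − ψ_E(λ_i)((X_i − μ̂_i)² − σ̂_i²)² ] } for t ≥ 1 is a nonnegative supermartingale with respect to (F_t). -/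
open MeasureTheory ProbabilityTheory Filter Finset

/-- Fan's inequality. -/
lemma fan_ineq {l x : ℝ} (h0 : 0 ≤ l) (h1 : l < 1) (hx : -1 ≤ x) :
    Real.exp (l * x - psiE l * x ^ 2) ≤ 1 + l * x := by
  have hpos : ∀ y ∈ Set.Ico (0:ℝ) 1, 0 < 1 + y * x := by
    intro y hy
    nlinarith [hy.1, hy.2, mul_le_mul_of_nonneg_left hx hy.1]
  have hder : ∀ y ∈ Set.Ico (0:ℝ) 1, HasDerivAt
      (fun y => Real.log (1 + y * x) - y * x + psiE y * x ^ 2)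
      (x / (1 + y * x) - x + (1 / (1 - y) - 1) * x ^ 2) y := by
    intro y hy
    have hp := hpos y hy
    have hq : 0 < 1 - y := by linarith [hy.2]
    have a1 : HasDerivAt (fun y : ℝ => y * x) x y := by
      simpa using (hasDerivAt_id y).mul_const x
    have a2 := (a1.const_add 1).log hp.ne'
    have a3 : HasDerivAt (fun y : ℝ => 1 - y) (-1) y := by
      simpa using (hasDerivAt_id y).const_sub 1
    have a4 := ((a3.log hq.ne').neg.sub (hasDerivAt_id y)).mul_const (x ^ 2)
    have a5 := (a2.sub a1).add a4
    refine a5.congr_deriv ?_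
    ring
  have hmono : MonotoneOn (fun y => Real.log (1 + y * x) - y * x + psiE y * x ^ 2)
      (Set.Ico (0:ℝ) 1) := by
    apply monotoneOn_of_deriv_nonneg (convex_Ico 0 1)
    · exact fun y hy => (hder y hy).continuousAt.continuousWithinAt
    · exact fun y hy =>
        (hder y (interior_subset hy)).differentiableAt.differentiableWithinAt
    · intro y hy
      have hy := interior_subset hy
      rw [(hder y hy).deriv]
      have hp := hpos y hy
      have hq : 0 < 1 - y := by linarith [hy.2]
      have e : x / (1 + y * x) - x + (1 / (1 - y) - 1) * x ^ 2
          = y ^ 2 * x ^ 2 * (1 + x) / ((1 + y * x) * (1 - y)) := by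
        have n1 : 1 + y * x ≠ 0 := hp.ne'
        have n3 : 1 + x * y ≠ 0 := by rwa [mul_comm x y]
        have n2 : 1 - y ≠ 0 := hq.ne'
        field_simp
        ring
      rw [e]
      have : 0 ≤ 1 + x := by linarith
      positivity
  have h := hmono (Set.mem_Ico.2 ⟨le_refl 0, one_pos⟩) (Set.mem_Ico.2 ⟨h0, h1⟩) h0
  simp only [psiE, zero_mul, add_zero, Real.log_one, sub_zero, neg_zero] at h
  rw [← Real.le_log_iff_exp_le (hpos l ⟨h0, h1⟩)]
  unfold psiE
  linarith

/-- Bounded and strongly measurable. -/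
def BddSM {Ω : Type*} (m : MeasurableSpace Ω) (f : Ω → ℝ) : Prop :=
  StronglyMeasurable[m] f ∧ ∃ c, ∀ ω, |f ω| ≤ c

lemma BddSM.add {Ω : Type*} {m : MeasurableSpace Ω} {f g : Ω → ℝ}
    (hf : BddSM m f) (hg : BddSM m g) : BddSM m (fun ω => f ω + g ω) := by
  obtain ⟨a, c, hc⟩ := hf
  obtain ⟨b, d, hd⟩ := hg
  exact ⟨a.add b, c + d, fun ω => (abs_add_le _ _).trans (add_le_add (hc ω) (hd ω))⟩

lemma BddSM.mul {Ω : Type*} {m : MeasurableSpace Ω} {f g : Ω → ℝ}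
    (hf : BddSM m f) (hg : BddSM m g) : BddSM m (fun ω => f ω * g ω) := by
  obtain ⟨a, c, hc⟩ := hf
  obtain ⟨b, d, hd⟩ := hg
  refine ⟨a.mul b, c * d, fun ω => ?_⟩
  rw [abs_mul]
  exact mul_le_mul (hc ω) (hd ω) (abs_nonneg _) ((abs_nonneg _).trans (hc ω))

lemma BddSM.const {Ω : Type*} {m : MeasurableSpace Ω} (c : ℝ) : BddSM m (fun _ : Ω => c) :=
  ⟨stronglyMeasurable_const, |c|, fun _ => le_rfl⟩

lemma BddSM.sub {Ω : Type*} {m : MeasurableSpace Ω} {f g : Ω → ℝ}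
    (hf : BddSM m f) (hg : BddSM m g) : BddSM m (fun ω => f ω - g ω) := by
  have := hf.add ((BddSM.const (-1)).mul hg)
  simpa [sub_eq_add_neg] using this

lemma BddSM.sq {Ω : Type*} {m : MeasurableSpace Ω} {f : Ω → ℝ}
    (hf : BddSM m f) : BddSM m (fun ω => f ω ^ 2) := by
  simpa [pow_two] using hf.mul hf

lemma BddSM.exp {Ω : Type*} {m : MeasurableSpace Ω} {f : Ω → ℝ}
    (hf : BddSM m f) : BddSM m (fun ω => Real.exp (f ω)) := by
  obtain ⟨a, c, hc⟩ := hf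
  refine ⟨Real.continuous_exp.comp_stronglyMeasurable a, Real.exp c, fun ω => ?_⟩
  rw [abs_of_pos (Real.exp_pos _)]
  exact Real.exp_le_exp.2 ((le_abs_self _).trans (hc ω))

lemma BddSM.of_Icc {Ω : Type*} {m : MeasurableSpace Ω} {f : Ω → ℝ}
    (hf : StronglyMeasurable[m] f) (h : ∀ ω, f ω ∈ Set.Icc (0:ℝ) 1) : BddSM m f :=
  ⟨hf, 1, fun ω => abs_le.2 ⟨by linarith [(h ω).1], (h ω).2⟩⟩

lemma BddSM.integrable_mul {Ω : Type*} {m m0 : MeasurableSpace Ω} {P : Measure Ω}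
    (hm : m ≤ m0) {f g : Ω → ℝ} (hf : BddSM m f) (hg : Integrable g P) :
    Integrable (f * g) P := by
  obtain ⟨a, c, hc⟩ := hf
  exact hg.bdd_mul (c := c) (a.mono hm).aestronglyMeasurable (ae_of_all _ hc)

lemma step_bound {Ω : Type*} {m m0 : MeasurableSpace Ω} (hm : m ≤ m0)
    (P : Measure Ω) [IsProbabilityMeasure P] (X a s l : Ω → ℝ) (μ σ2 : ℝ)
    (hint : Integrable X P)
    (hbdd : ∀ᵐ ω ∂P, X ω ∈ Set.Icc (0:ℝ) 1)
    (hmean : P[X|m] =ᵐ[P] fun _ => μ)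
    (hvar : P[(fun ω => (X ω - μ)^2)|m] =ᵐ[P] fun _ => σ2)
    (ha : StronglyMeasurable[m] a) (ha' : ∀ ω, a ω ∈ Set.Icc (0:ℝ) 1)
    (hs : StronglyMeasurable[m] s) (hs' : ∀ ω, s ω ∈ Set.Icc (0:ℝ) 1)
    (hl : StronglyMeasurable[m] l) (hl' : ∀ ω, l ω ∈ Set.Ico (0:ℝ) 1)
    (hZ : Integrable (fun ω => Real.exp (l ω * ((σ2 + (a ω - μ)^2) - (X ω - a ω)^2)
          - psiE (l ω) * ((X ω - a ω)^2 - (s ω)^2)^2)) P) :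
    P[(fun ω => Real.exp (l ω * ((σ2 + (a ω - μ)^2) - (X ω - a ω)^2)
          - psiE (l ω) * ((X ω - a ω)^2 - (s ω)^2)^2))|m] ≤ᵐ[P] fun _ => 1 := by
  have Ba := BddSM.of_Icc ha ha'
  have Bs := BddSM.of_Icc hs hs'
  have Bl := BddSM.of_Icc hl (fun ω => ⟨(hl' ω).1, (hl' ω).2.le⟩)
  let H : Ω → ℝ := fun ω => Real.exp (l ω * ((σ2 + (a ω - μ)^2) - (s ω)^2))
  have BH : BddSM m H :=
    (Bl.mul (((BddSM.const σ2).add (Ba.sub (BddSM.const μ)).sq).sub Bs.sq)).exp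
  -- coefficients
  let B : Ω → ℝ := fun ω => -1 * (H ω * l ω)
  let C : Ω → ℝ := fun ω => 2 * ((H ω * l ω) * (a ω - μ))
  let A : Ω → ℝ := fun ω => H ω * (1 + l ω * ((s ω)^2 - (a ω - μ)^2)) - μ * C ω
  have BB : BddSM m B := (BddSM.const (-1)).mul (BH.mul Bl)
  have BC : BddSM m C := (BddSM.const 2).mul ((BH.mul Bl).mul (Ba.sub (BddSM.const μ)))
  have BA : BddSM m A := (BH.mul ((BddSM.const 1).add (Bl.mul
    (Bs.sq.sub (Ba.sub (BddSM.const μ)).sq)))).sub ((BddSM.const μ).mul BC)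
  have hV : Integrable (fun ω => (X ω - μ)^2) P := by
    refine Integrable.of_bound
      ((hint.aestronglyMeasurable.sub aestronglyMeasurable_const).pow 2) ((1 + |μ|)^2) ?_
    filter_upwards [hbdd] with ω hω
    rw [Real.norm_eq_abs, abs_pow]
    refine pow_le_pow_left₀ (abs_nonneg _) ?_ 2
    refine (abs_sub _ _).trans ?_
    rw [abs_of_nonneg hω.1]
    linarith [hω.2]
  have iA : Integrable A P := by
    have := BA.integrable_mul hm (integrable_const (μ := P) (1:ℝ))
    refine this.congr (ae_of_all _ fun ω => by simp)
  have iB := BB.integrable_mul hm hV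
  have iC := BC.integrable_mul hm hint
  have hle : (fun ω => Real.exp (l ω * ((σ2 + (a ω - μ)^2) - (X ω - a ω)^2)
          - psiE (l ω) * ((X ω - a ω)^2 - (s ω)^2)^2)) ≤ᵐ[P]
      A + B * (fun ω => (X ω - μ)^2) + C * X := by
    filter_upwards [hbdd] with ω hω
    have h1 : -1 ≤ (s ω)^2 - (X ω - a ω)^2 := by
      have := ha' ω
      have h2 : (X ω - a ω)^2 ≤ 1 := by
        rw [sq_le_one_iff_abs_le_one, abs_le]
        constructor <;> linarith [hω.1, hω.2, this.1, this.2]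
      nlinarith [sq_nonneg (s ω)]
    have h2 := mul_le_mul_of_nonneg_left (fan_ineq (hl' ω).1 (hl' ω).2 h1)
      (Real.exp_pos (l ω * ((σ2 + (a ω - μ)^2) - (s ω)^2))).le
    rw [← Real.exp_add] at h2
    have e1 : l ω * ((σ2 + (a ω - μ)^2) - (X ω - a ω)^2)
          - psiE (l ω) * ((X ω - a ω)^2 - (s ω)^2)^2
        = l ω * ((σ2 + (a ω - μ)^2) - (s ω)^2) + (l ω * ((s ω)^2 - (X ω - a ω)^2)
          - psiE (l ω) * ((s ω)^2 - (X ω - a ω)^2)^2) := by ring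
    rw [e1]
    refine h2.trans (le_of_eq ?_)
    simp only [Pi.add_apply, Pi.mul_apply, A, B, C, H]
    ring
  have c1 := condExp_mono (m := m) hZ ((iA.add iB).add iC) hle
  have c2 := condExp_add (iA.add iB) iC m
  have c3 := condExp_add iA iB m
  have c4 : P[A|m] = A := condExp_of_stronglyMeasurable hm BA.1 iA
  have c5 := condExp_mul_of_stronglyMeasurable_left BB.1 iB hV
  have c6 := condExp_mul_of_stronglyMeasurable_left BC.1 iC hint
  filter_upwards [c1, c2, c3, c5, c6, hmean, hvar] with ω d1 d2 d3 d5 d6 d7 d8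
  refine d1.trans ?_
  rw [d2, Pi.add_apply, d3, Pi.add_apply, c4, d5, d6, Pi.mul_apply, Pi.mul_apply, d7, d8]
  simp only [A, B, C, H]
  set u := l ω * ((σ2 + (a ω - μ)^2) - (s ω)^2) with hu
  have e2 : 1 - u ≤ Real.exp (-u) := by linarith [Real.add_one_le_exp (-u)]
  have e3 := mul_le_mul_of_nonneg_left e2 (Real.exp_pos u).le
  rw [← Real.exp_add, add_neg_cancel, Real.exp_zero] at e3
  refine le_trans (le_of_eq ?_) e3
  rw [show 1 - u = 1 - l ω * ((σ2 + (a ω - μ)^2) - (s ω)^2) from rfl]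
  ring

/-- Theorem 4 of the paper, the `S⁻` process: a nonnegative supermartingale. -/
theorem supermartingale_minus
    {Ω : Type*} {m0 : MeasurableSpace Ω} (P : Measure Ω) [IsProbabilityMeasure P]
    (ℱ : Filtration ℕ m0) (X muhat sighat lam : ℕ → Ω → ℝ) (μ σ2 : ℝ)
    (hadapt : Adapted ℱ X)
    (hint : ∀ t, 1 ≤ t → Integrable (X t) P)
    (hbdd : ∀ t, 1 ≤ t → ∀ᵐ ω ∂P, X t ω ∈ Set.Icc (0:ℝ) 1)
    (hmean : ∀ t, 1 ≤ t → P[X t|ℱ (t - 1)] =ᵐ[P] fun _ => μ)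
    (hvar : ∀ t, 1 ≤ t → P[(fun ω => (X t ω - μ)^2)|ℱ (t - 1)] =ᵐ[P] fun _ => σ2)
    (hmu_pred : ∀ t, 1 ≤ t → StronglyMeasurable[ℱ (t - 1)] (muhat t))
    (hmu_mem : ∀ t, 1 ≤ t → ∀ ω, muhat t ω ∈ Set.Icc (0:ℝ) 1)
    (hsig_pred : ∀ t, 1 ≤ t → StronglyMeasurable[ℱ (t - 1)] (sighat t))
    (hsig_mem : ∀ t, 1 ≤ t → ∀ ω, sighat t ω ∈ Set.Icc (0:ℝ) 1)
    (hlam_pred : ∀ t, 1 ≤ t → StronglyMeasurable[ℱ (t - 1)] (lam t))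
    (hlam_mem : ∀ t, 1 ≤ t → ∀ ω, lam t ω ∈ Set.Ico (0:ℝ) 1)
    (S : ℕ → Ω → ℝ)
    (hS : S = fun t ω => Real.exp (∑ i ∈ Finset.Icc 1 t,
        (lam i ω * ((σ2 + (muhat i ω - μ)^2) - (X i ω - muhat i ω)^2)
          - psiE (lam i ω) * ((X i ω - muhat i ω)^2 - (sighat i ω)^2)^2))) :
    (∀ t ω, 0 ≤ S t ω) ∧ Supermartingale S ℱ P := by
  let D : ℕ → Ω → ℝ := fun i ω =>
    lam i ω * ((σ2 + (muhat i ω - μ)^2) - (X i ω - muhat i ω)^2)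
          - psiE (lam i ω) * ((X i ω - muhat i ω)^2 - (sighat i ω)^2)^2
  have hSD : ∀ t ω, S t ω = Real.exp (∑ i ∈ Finset.Icc 1 t, D i ω) := by
    intro t ω; rw [hS]
  have hDm : ∀ t, 1 ≤ t → Measurable[ℱ t] (D t) := by
    intro t ht
    have hle : ℱ (t - 1) ≤ ℱ t := ℱ.mono (Nat.sub_le _ _)
    have m1 := hadapt t
    have m2 := ((hmu_pred t ht).mono hle).measurable
    have m3 := ((hsig_pred t ht).mono hle).measurable
    have m4 := ((hlam_pred t ht).mono hle).measurable
    have m5 : Measurable psiE := by unfold psiE; fun_prop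
    have m6 := m5.comp m4
    exact (m4.mul ((measurable_const.add ((m2.sub measurable_const).pow_const 2)).sub
      ((m1.sub m2).pow_const 2))).sub
      (m6.mul ((((m1.sub m2).pow_const 2).sub (m3.pow_const 2)).pow_const 2))
  let K : ℝ := |σ2| + (1 + |μ|)^2
  have hDK : ∀ t, 1 ≤ t → ∀ ω, D t ω ≤ K := by
    intro t ht ω
    have hl := hlam_mem t ht ω
    have hm := hmu_mem t ht ω
    have h1 : 0 ≤ psiE (lam t ω) * ((X t ω - muhat t ω)^2 - (sighat t ω)^2)^2 :=
      mul_nonneg (psiE_nonneg hl.2) (sq_nonneg _)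
    have h2 : (muhat t ω - μ)^2 ≤ (1 + |μ|)^2 := by
      rw [← sq_abs]
      refine pow_le_pow_left₀ (abs_nonneg _) ?_ 2
      refine (abs_sub _ _).trans ?_
      rw [abs_of_nonneg hm.1]
      linarith [hm.2]
    have hK : 0 ≤ K := by positivity
    have h3 : (σ2 + (muhat t ω - μ)^2) - (X t ω - muhat t ω)^2 ≤ K := by
      have := le_abs_self σ2
      have := sq_nonneg (X t ω - muhat t ω)
      simp only [K]; linarith
    have h4 := mul_le_mul_of_nonneg_left h3 hl.1
    have h5 := mul_le_mul_of_nonneg_right hl.2.le hK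
    simp only [D]
    linarith
  have hadp : StronglyAdapted ℱ S := by
    intro t
    have : S t = fun ω => Real.exp (∑ i ∈ Finset.Icc 1 t, D i ω) := funext (hSD t)
    rw [this]
    refine Measurable.stronglyMeasurable ?_
    refine Real.measurable_exp.comp (Finset.measurable_fun_sum _ fun i hi => ?_)
    rw [Finset.mem_Icc] at hi
    exact (hDm i hi.1).mono (ℱ.mono hi.2) le_rfl
  have hSint : ∀ t, Integrable (S t) P := by
    intro t
    refine Integrable.of_bound ((hadp t).mono (ℱ.le t)).aestronglyMeasurable
      (Real.exp (∑ i ∈ Finset.Icc 1 t, K)) (ae_of_all _ fun ω => ?_)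
    rw [hSD, Real.norm_eq_abs, abs_of_pos (Real.exp_pos _)]
    exact Real.exp_le_exp.2 (Finset.sum_le_sum fun i hi =>
      hDK i (Finset.mem_Icc.1 hi).1 ω)
  refine ⟨fun t ω => by rw [hSD]; exact (Real.exp_pos _).le, ?_⟩
  refine supermartingale_nat hadp hSint fun t => ?_
  have ht : 1 ≤ t + 1 := Nat.le_add_left 1 t
  have hZ : Integrable (fun ω => Real.exp (D (t+1) ω)) P := by
    refine Integrable.of_bound (Real.measurable_exp.comp
      ((hDm (t+1) ht).mono (ℱ.le _) le_rfl)).aestronglyMeasurable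
      (Real.exp K) (ae_of_all _ fun ω => ?_)
    rw [Real.norm_eq_abs, abs_of_pos (Real.exp_pos _)]
    exact Real.exp_le_exp.2 (hDK (t+1) ht ω)
  have hmul : S (t+1) = S t * fun ω => Real.exp (D (t+1) ω) := by
    funext ω
    rw [Pi.mul_apply, hSD, hSD, Finset.sum_Icc_succ_top ht, Real.exp_add]
  have hstep := step_bound (ℱ.le t) P (X (t+1)) (muhat (t+1)) (sighat (t+1)) (lam (t+1)) μ σ2
    (hint _ ht) (hbdd _ ht) (hmean _ ht) (hvar _ ht) (hmu_pred _ ht) (hmu_mem _ ht)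
    (hsig_pred _ ht) (hsig_mem _ ht) (hlam_pred _ ht) (hlam_mem _ ht) hZ
  have hpull := condExp_mul_of_stronglyMeasurable_left (hadp t)
    (hmul ▸ hSint (t+1)) hZ
  rw [hmul]
  filter_upwards [hstep, hpull] with ω h1 h2
  rw [h2, Pi.mul_apply]
  have h3 : 0 ≤ S t ω := by rw [hSD]; exact (Real.exp_pos _).le
  exact mul_le_of_le_one_right h3 h1
end

section
/- Upper empirical Bernstein inequality for the variance: let X_1, X_2, ... satisfy Assumption 1 with conditional mean μ and conditional variance σ². For any [0,1]-valued predictable sequences (μ̂_i)_{i≥1} and (σ̂_i)_{i≥1} and any [0,1)-valued predictable sequence (λ_i)_{i≥1} with λ_1 > 0, the probability that there exists t ≥ 1 with σ² ≥ U_t := D_t + R_{t,α} is at most α; that is, (−∞, U_t) is a (1−α) upper confidence sequence for σ². -/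
open MeasureTheory ProbabilityTheory Filter Finset

variable {Ω : Type*}

/-- `D_t := (Σ_{i≤t} λ_i (X_i − μ̂_i)²) / (Σ_{i≤t} λ_i)`. -/
noncomputable def Dproc (lam X muhat : ℕ → Ω → ℝ) (t : ℕ) (ω : Ω) : ℝ :=
  (∑ i ∈ Finset.Icc 1 t, lam i ω * (X i ω - muhat i ω)^2) / (∑ i ∈ Finset.Icc 1 t, lam i ω)

/-- `R_{t,α} := (log(1/α) + Σ_{i≤t} ψ_E(λ_i)((X_i − μ̂_i)² − σ̂_i²)²) / (Σ_{i≤t} λ_i)`. -/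
noncomputable def Rproc (lam X muhat sighat : ℕ → Ω → ℝ) (a : ℝ) (t : ℕ) (ω : Ω) : ℝ :=
  (Real.log (1/a) + ∑ i ∈ Finset.Icc 1 t,
      psiE (lam i ω) * ((X i ω - muhat i ω)^2 - (sighat i ω)^2)^2) /
    (∑ i ∈ Finset.Icc 1 t, lam i ω)

lemma aux_fan {x l : ℝ} (hx : -1 ≤ x) (hl0 : 0 ≤ l) (hl1 : l < 1) :
    Real.exp (l * x - psiE l * x ^ 2) ≤ 1 + l * x := by
  have hpos : ∀ y ∈ Set.Ico (0:ℝ) 1, 0 < 1 + y * x := by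
    intro y hy
    nlinarith [hy.1, hy.2, mul_nonneg hy.1 (by linarith : 0 ≤ x + 1)]
  rw [← Real.le_log_iff_exp_le (hpos l ⟨hl0, hl1⟩)]
  let f : ℝ → ℝ := fun y => Real.log (1 + y * x) - (y * x - psiE y * x ^ 2)
  have hder : ∀ y ∈ Set.Ico (0:ℝ) 1, HasDerivAt f
      (x / (1 + y * x) - (x - (1 / (1 - y) - 1) * x ^ 2)) y := by
    intro y hy
    have h1 : HasDerivAt (fun y : ℝ => 1 + y * x) x y := by
      simpa using ((hasDerivAt_id y).mul_const x).const_add 1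
    have h2 : HasDerivAt (fun y : ℝ => 1 - y) (-1) y := by
      simpa using (hasDerivAt_id y).const_sub 1
    have h3 := h1.log (hpos y hy).ne'
    have h4 := h2.log (by linarith [hy.2] : (0:ℝ) < 1 - y).ne'
    have h5 := (h4.neg.sub (hasDerivAt_id y)).mul_const (x ^ 2)
    have h6 := h3.sub (((hasDerivAt_id y).mul_const x).sub h5)
    refine HasDerivAt.congr_deriv (f := f) h6 ?_
    ring
  have hmono : MonotoneOn f (Set.Ico (0:ℝ) 1) := by
    apply monotoneOn_of_deriv_nonneg (convex_Ico 0 1)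
    · intro y hy
      exact (hder y hy).continuousAt.continuousWithinAt
    · intro y hy
      rw [interior_Ico] at hy
      exact (hder y ⟨hy.1.le, hy.2⟩).differentiableAt.differentiableWithinAt
    · intro y hy
      rw [interior_Ico] at hy
      rw [(hder y ⟨hy.1.le, hy.2⟩).deriv]
      have hp := hpos y ⟨hy.1.le, hy.2⟩
      have hq : 0 < 1 - y := by linarith [hy.2]
      have : x / (1 + y * x) - (x - (1 / (1 - y) - 1) * x ^ 2)
          = y ^ 2 * x ^ 2 * (x + 1) / ((1 + y * x) * (1 - y)) := by
        have hp' := hp.ne'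
        have hq' := hq.ne'
        rw [eq_div_iff (mul_ne_zero hp' hq')]
        have e1 : x / (1 + y * x) * (1 + y * x) = x := div_mul_cancel₀ _ hp'
        have e2 : 1 / (1 - y) * (1 - y) = 1 := div_mul_cancel₀ _ hq'
        linear_combination (1 - y) * e1 + x ^ 2 * (1 + y * x) * e2
      rw [this]
      have : 0 ≤ x + 1 := by linarith
      positivity
  have := hmono (Set.left_mem_Ico.2 zero_lt_one) ⟨hl0, hl1⟩ hl0
  simp only [f, psiE] at this ⊢
  simp at this
  linarith

/-- Stopped product. -/
noncomputable def auxS {Ω : Type*} (G : ℕ → Ω → ℝ) (c : ℝ) : ℕ → Ω → ℝ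
  | 0 => fun _ => 1
  | n + 1 => fun ω => if c ≤ auxS G c n ω then auxS G c n ω else auxS G c n ω * G n ω

lemma aux_ville {Ω : Type*} {m0 : MeasurableSpace Ω} (P : Measure Ω) [IsProbabilityMeasure P]
    (ℱ : Filtration ℕ m0) (G : ℕ → Ω → ℝ) (B c : ℝ) (hB : 1 ≤ B) (hc : 0 < c)
    (hGm : ∀ n, Measurable[ℱ (n + 1)] (G n))
    (hG0 : ∀ n ω, 0 ≤ G n ω) (hGB : ∀ n ω, G n ω ≤ B)
    (hG : ∀ n, P[G n|ℱ n] ≤ᵐ[P] fun _ => 1) :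
    P {ω | ∃ n, c ≤ ∏ i ∈ Finset.range n, G i ω} ≤ ENNReal.ofReal (1 / c) := by
  set S := auxS G c with hS
  have hSs : ∀ n ω, S (n + 1) ω = if c ≤ S n ω then S n ω else S n ω * G n ω := fun n ω => rfl
  have hSm : ∀ n, Measurable[ℱ n] (S n) := by
    intro n
    induction n with
    | zero => exact measurable_const
    | succ n ih =>
      have ih' : Measurable[ℱ (n + 1)] (S n) := ih.mono (ℱ.mono n.le_succ) le_rfl
      exact Measurable.ite (measurableSet_le measurable_const ih') ih' (ih'.mul (hGm n))
  have hS0 : ∀ n ω, 0 ≤ S n ω := by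
    intro n ω
    induction n with
    | zero => exact zero_le_one
    | succ n ih =>
      rw [hSs]
      split_ifs
      · exact ih
      · exact mul_nonneg ih (hG0 n ω)
  have hSB : ∀ n ω, S n ω ≤ B ^ n := by
    intro n ω
    induction n with
    | zero => simp [hS, auxS]
    | succ n ih =>
      rw [hSs, pow_succ]
      split_ifs
      · nlinarith [pow_nonneg (zero_le_one.trans hB) n]
      · exact mul_le_mul ih (hGB n ω) (hG0 n ω) (by positivity)
  have hbi : ∀ (f : Ω → ℝ) (C : ℝ), Measurable f → (∀ ω, 0 ≤ f ω) → (∀ ω, f ω ≤ C) →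
      Integrable f P := by
    intro f C hf h0 hC
    exact Integrable.of_bound hf.aestronglyMeasurable C
      (Eventually.of_forall fun ω => by rw [Real.norm_of_nonneg (h0 ω)]; exact hC ω)
  have hSi : ∀ n, Integrable (S n) P := fun n =>
    hbi _ _ ((hSm n).mono (ℱ.le n) le_rfl) (hS0 n) (hSB n)
  have hGi : ∀ n, Integrable (G n) P := fun n =>
    hbi _ _ ((hGm n).mono (ℱ.le _) le_rfl) (hG0 n) (hGB n)
  have hstep : ∀ n, ∫ ω, S (n + 1) ω ∂P ≤ ∫ ω, S n ω ∂P := by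
    intro n
    let U : Ω → ℝ := fun ω => if c ≤ S n ω then S n ω else 0
    let V : Ω → ℝ := fun ω => if c ≤ S n ω then 0 else S n ω
    have hms : MeasurableSet[ℱ n] {ω | c ≤ S n ω} := measurableSet_le measurable_const (hSm n)
    have hUm : Measurable[ℱ n] U := Measurable.ite hms (hSm n) measurable_const
    have hVm : Measurable[ℱ n] V := Measurable.ite hms measurable_const (hSm n)
    have hV0 : ∀ ω, 0 ≤ V ω := by
      intro ω; simp only [V]; split_ifs; exacts [le_rfl, hS0 n ω]
    have hVB : ∀ ω, V ω ≤ B ^ n := by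
      intro ω; simp only [V]; split_ifs; exacts [by positivity, hSB n ω]
    have hU0 : ∀ ω, 0 ≤ U ω := by
      intro ω; simp only [U]; split_ifs; exacts [hS0 n ω, le_rfl]
    have hUB : ∀ ω, U ω ≤ B ^ n := by
      intro ω; simp only [U]; split_ifs; exacts [hSB n ω, by positivity]
    have hUi : Integrable U P := hbi _ _ (hUm.mono (ℱ.le n) le_rfl) hU0 hUB
    have hVi : Integrable V P := hbi _ _ (hVm.mono (ℱ.le n) le_rfl) hV0 hVB
    have hVGi : Integrable (V * G n) P :=
      hbi _ (B ^ n * B) ((hVm.mono (ℱ.le n) le_rfl).mul ((hGm n).mono (ℱ.le _) le_rfl))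
        (fun ω => mul_nonneg (hV0 ω) (hG0 n ω))
        (fun ω => mul_le_mul (hVB ω) (hGB n ω) (hG0 n ω) (by positivity))
    have e1 : ∀ ω, S (n + 1) ω = U ω + (V * G n) ω := by
      intro ω
      rw [hSs]; simp only [U, V, Pi.mul_apply]
      split_ifs <;> simp
    have e2 : ∀ ω, S n ω = U ω + V ω := by
      intro ω
      simp only [U, V]
      split_ifs <;> simp
    have hpull : P[V * G n|ℱ n] =ᵐ[P] V * P[G n|ℱ n] :=
      condExp_mul_of_stronglyMeasurable_left hVm.stronglyMeasurable hVGi (hGi n)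
    have hle : ∫ ω, (V * G n) ω ∂P ≤ ∫ ω, V ω ∂P := by
      rw [← integral_condExp (ℱ.le n)]
      apply integral_mono_ae integrable_condExp hVi
      filter_upwards [hpull, hG n] with ω h1 h2
      rw [h1]
      simpa using mul_le_mul_of_nonneg_left h2 (hV0 ω)
    simp_rw [e1, e2]
    rw [integral_add hUi hVGi, integral_add hUi hVi]
    linarith
  have hint : ∀ n, ∫ ω, S n ω ∂P ≤ 1 := by
    intro n
    induction n with
    | zero => simp [hS, auxS]
    | succ n ih => exact (hstep n).trans ih
  have hmk : ∀ n, P {ω | c ≤ S n ω} ≤ ENNReal.ofReal (1 / c) := by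
    intro n
    have h := mul_meas_ge_le_integral_of_nonneg (Eventually.of_forall (hS0 n)) (hSi n) c
    rw [← ofReal_measureReal]
    apply ENNReal.ofReal_le_ofReal
    rw [le_div_iff₀ hc, mul_comm]
    exact h.trans (hint n)
  have hmon : Monotone fun n => {ω | c ≤ S n ω} := by
    apply monotone_nat_of_le_succ
    intro n ω (hω : c ≤ S n ω)
    change c ≤ S (n + 1) ω
    rw [hSs, if_pos hω]; exact hω
  have hsub : {ω | ∃ n, c ≤ ∏ i ∈ Finset.range n, G i ω} ⊆ ⋃ n, {ω | c ≤ S n ω} := by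
    rintro ω ⟨n, hn⟩
    by_contra hcon
    simp only [Set.mem_iUnion, Set.mem_ofPred_eq, not_exists] at hcon
    have : ∀ k, S k ω = ∏ i ∈ Finset.range k, G i ω := by
      intro k
      induction k with
      | zero => simp [hS, auxS]
      | succ k ih => rw [hSs, if_neg (hcon k), ih, Finset.prod_range_succ]
    exact hcon n (this n ▸ hn)
  refine (measure_mono hsub).trans ?_
  rw [hmon.measure_iUnion]
  exact iSup_le hmk

lemma aux_condExp {Ω : Type*} {m m0 : MeasurableSpace Ω} (hm : m ≤ m0)
    (P : Measure Ω) [IsProbabilityMeasure P] (X mh s l : Ω → ℝ) (μ σ2 : ℝ)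
    (hX : Measurable X) (hX01 : ∀ ω, X ω ∈ Set.Icc (0:ℝ) 1)
    (hmean : P[X|m] =ᵐ[P] fun _ => μ)
    (hvar : P[(fun ω => (X ω - μ)^2)|m] =ᵐ[P] fun _ => σ2)
    (hmh : Measurable[m] mh) (hmh01 : ∀ ω, mh ω ∈ Set.Icc (0:ℝ) 1)
    (hs : Measurable[m] s) (hs01 : ∀ ω, s ω ∈ Set.Icc (0:ℝ) 1)
    (hl : Measurable[m] l) (hl01 : ∀ ω, l ω ∈ Set.Ico (0:ℝ) 1) :
    P[(fun ω => Real.exp (l ω * (σ2 - s ω ^ 2)) * (1 + l ω * (s ω ^ 2 - (X ω - mh ω) ^ 2)))|m]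
      ≤ᵐ[P] fun _ => 1 := by
  let W : Ω → ℝ := fun ω => Real.exp (l ω * (σ2 - s ω ^ 2))
  have hWm : Measurable[m] W := Real.measurable_exp.comp (hl.mul (measurable_const.sub (hs.pow_const 2)))
  have hW0 : ∀ ω, 0 ≤ W ω := fun ω => (Real.exp_pos _).le
  have hWB : ∀ ω, W ω ≤ Real.exp |σ2| := by
    intro ω
    apply Real.exp_le_exp.2
    have := hl01 ω
    nlinarith [this.1, this.2, le_abs_self σ2, abs_nonneg σ2, mul_nonneg this.1 (sq_nonneg (s ω)),
      mul_nonneg this.1 (sub_nonneg.2 (le_abs_self σ2))]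
  have hbi : ∀ (f : Ω → ℝ) (C : ℝ), Measurable f → (∀ ω, |f ω| ≤ C) → Integrable f P :=
    fun f C hf hC => Integrable.of_bound hf.aestronglyMeasurable C (Eventually.of_forall hC)
  have hs2 : ∀ ω, |s ω ^ 2| ≤ 1 := fun ω => by
    rw [abs_le]; constructor <;> nlinarith [(hs01 ω).1, (hs01 ω).2]
  have hl1 : ∀ ω, |l ω| ≤ 1 := fun ω => by
    rw [abs_le]; constructor <;> linarith [(hl01 ω).1, (hl01 ω).2]
  have hmh1 : ∀ ω, |μ - mh ω| ≤ |μ| + 1 := fun ω => by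
    refine (abs_sub _ _).trans ?_
    have : |mh ω| ≤ 1 := by rw [abs_le]; constructor <;> linarith [(hmh01 ω).1, (hmh01 ω).2]
    linarith
  have hX1 : ∀ ω, |X ω - μ| ≤ |μ| + 1 := fun ω => by
    refine (abs_sub _ _).trans ?_
    have : |X ω| ≤ 1 := by rw [abs_le]; constructor <;> linarith [(hX01 ω).1, (hX01 ω).2]
    linarith
  have hW1 : ∀ ω, |W ω| ≤ Real.exp |σ2| := fun ω => by rw [abs_of_nonneg (hW0 ω)]; exact hWB ω
  let a : Ω → ℝ := fun ω => W ω * (1 + l ω * (s ω ^ 2 - (μ - mh ω) ^ 2))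
  let b : Ω → ℝ := fun ω => - (W ω * l ω)
  let d : Ω → ℝ := fun ω => W ω * l ω * (-2 * (μ - mh ω))
  let Z : Ω → ℝ := fun ω => X ω - μ
  let Q : Ω → ℝ := fun ω => (X ω - μ) ^ 2
  have hZm : Measurable Z := hX.sub measurable_const
  have hQm : Measurable Q := hZm.pow_const 2
  have ham : Measurable[m] a := hWm.mul (measurable_const.add
    (hl.mul ((hs.pow_const 2).sub ((measurable_const.sub hmh).pow_const 2))))
  have hbm : Measurable[m] b := (hWm.mul hl).neg
  have hdm : Measurable[m] d := (hWm.mul hl).mul (measurable_const.mul (measurable_const.sub hmh))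
  have hbB : ∀ ω, |b ω| ≤ Real.exp |σ2| * 1 := fun ω => by
    simp only [b, abs_neg, abs_mul]
    exact mul_le_mul (hW1 ω) (hl1 ω) (abs_nonneg _) (by positivity)
  have hdB : ∀ ω, |d ω| ≤ Real.exp |σ2| * 1 * (2 * (|μ| + 1)) := fun ω => by
    simp only [d, abs_mul, abs_neg, abs_two]
    gcongr
    exacts [hW1 ω, hl1 ω, hmh1 ω]
  have haB : ∀ ω, |a ω| ≤ Real.exp |σ2| * (1 + 1 * (1 + (|μ| + 1) ^ 2)) := fun ω => by
    have h1 : |s ω ^ 2 - (μ - mh ω) ^ 2| ≤ 1 + (|μ| + 1) ^ 2 := by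
      refine (abs_sub _ _).trans ?_
      rw [abs_pow (μ - mh ω)]
      gcongr
      exacts [hs2 ω, hmh1 ω]
    have h2 : |1 + l ω * (s ω ^ 2 - (μ - mh ω) ^ 2)| ≤ 1 + 1 * (1 + (|μ| + 1) ^ 2) := by
      refine (abs_add_le _ _).trans ?_
      rw [abs_one, abs_mul]
      gcongr
      exact hl1 ω
    simp only [a, abs_mul]
    exact mul_le_mul (hW1 ω) h2 (abs_nonneg _) (by positivity)
  have hQB : ∀ ω, |Q ω| ≤ (|μ| + 1) ^ 2 := fun ω => by
    simp only [Q, abs_pow]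
    gcongr
    exact hX1 ω
  have hai := hbi a _ (ham.mono hm le_rfl) haB
  have hZi := hbi Z _ hZm hX1
  have hQi := hbi Q _ hQm hQB
  have hXi : Integrable X P := hbi X 1 hX fun ω => by
    rw [abs_le]; constructor <;> linarith [(hX01 ω).1, (hX01 ω).2]
  have hbQi : Integrable (b * Q) P := hbi _ (Real.exp |σ2| * 1 * (|μ| + 1) ^ 2)
    ((hbm.mono hm le_rfl).mul hQm) fun ω => by
      simp only [Pi.mul_apply, abs_mul (b ω)]
      exact mul_le_mul (hbB ω) (hQB ω) (abs_nonneg _) (by positivity)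
  have hdZi : Integrable (d * Z) P := hbi _ (Real.exp |σ2| * 1 * (2 * (|μ| + 1)) * (|μ| + 1))
    ((hdm.mono hm le_rfl).mul hZm) fun ω => by
      simp only [Pi.mul_apply, abs_mul (d ω)]
      exact mul_le_mul (hdB ω) (hX1 ω) (abs_nonneg _) (by positivity)
  have heq : (fun ω => Real.exp (l ω * (σ2 - s ω ^ 2)) *
      (1 + l ω * (s ω ^ 2 - (X ω - mh ω) ^ 2))) = a + (b * Q + d * Z) := by
    funext ω
    simp only [Pi.add_apply, Pi.mul_apply, a, b, d, Q, Z, W]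
    ring
  rw [heq]
  have hZc : P[Z|m] =ᵐ[P] fun _ => 0 := by
    have h := condExp_sub hXi (integrable_const μ) m (μ := P)
    have h' : P[(fun _ => μ : Ω → ℝ)|m] = fun _ => μ := condExp_const hm μ
    filter_upwards [h, hmean] with ω h1 h2
    change (P[X - (fun _ => μ)|m]) ω = 0
    rw [h1, Pi.sub_apply, h2, h', sub_self]
  have hac : P[a|m] = a := condExp_of_stronglyMeasurable hm ham.stronglyMeasurable hai
  filter_upwards [condExp_add hai (hbQi.add hdZi) m, condExp_add hbQi hdZi m,
    condExp_mul_of_stronglyMeasurable_left hbm.stronglyMeasurable hbQi hQi,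
    condExp_mul_of_stronglyMeasurable_left hdm.stronglyMeasurable hdZi hZi, hZc, hvar]
    with ω h1 h2 h3 h4 h5 h6
  rw [h1, Pi.add_apply, h2, Pi.add_apply, h3, h4, Pi.mul_apply, Pi.mul_apply, h5, h6, hac]
  have hle : 1 + l ω * (s ω ^ 2 - σ2 - (μ - mh ω) ^ 2) ≤ Real.exp (l ω * (s ω ^ 2 - σ2)) := by
    have := Real.add_one_le_exp (l ω * (s ω ^ 2 - σ2))
    nlinarith [mul_nonneg (hl01 ω).1 (sq_nonneg (μ - mh ω))]
  calc a ω + (b ω * σ2 + d ω * 0) = W ω * (1 + l ω * (s ω ^ 2 - σ2 - (μ - mh ω) ^ 2)) := by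
        simp only [a, b]; ring
    _ ≤ W ω * Real.exp (l ω * (s ω ^ 2 - σ2)) := mul_le_mul_of_nonneg_left hle (hW0 ω)
    _ = 1 := by
        simp only [W]
        rw [← Real.exp_add, ← Real.exp_zero]
        congr 1; ring

lemma aux_sum (f : ℕ → ℝ) (t : ℕ) :
    ∑ i ∈ Finset.Icc 1 t, f i = ∑ i ∈ Finset.range t, f (i + 1) := by
  induction t with
  | zero => simp
  | succ n ih => rw [Finset.sum_Icc_succ_top (by omega), ih, Finset.sum_range_succ]

/-- Corollary 2 of the paper: upper empirical Bernstein confidence sequence for the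
variance, `(−∞, U_t)` with `U_t = D_t + R_{t,α}`. -/
theorem upper_empirical_bernstein_variance
    {m0 : MeasurableSpace Ω} (P : Measure Ω) [IsProbabilityMeasure P]
    (ℱ : Filtration ℕ m0) (X muhat sighat lam : ℕ → Ω → ℝ) (μ σ2 α : ℝ)
    (hα : α ∈ Set.Ioo (0:ℝ) 1)
    (hadapt : Adapted ℱ X)
    (hint : ∀ t, 1 ≤ t → Integrable (X t) P)
    (hbdd : ∀ t, 1 ≤ t → ∀ᵐ ω ∂P, X t ω ∈ Set.Icc (0:ℝ) 1)
    (hmean : ∀ t, 1 ≤ t → P[X t|ℱ (t - 1)] =ᵐ[P] fun _ => μ)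
    (hvar : ∀ t, 1 ≤ t → P[(fun ω => (X t ω - μ)^2)|ℱ (t - 1)] =ᵐ[P] fun _ => σ2)
    (hmu_pred : ∀ t, 1 ≤ t → StronglyMeasurable[ℱ (t - 1)] (muhat t))
    (hmu_mem : ∀ t, 1 ≤ t → ∀ ω, muhat t ω ∈ Set.Icc (0:ℝ) 1)
    (hsig_pred : ∀ t, 1 ≤ t → StronglyMeasurable[ℱ (t - 1)] (sighat t))
    (hsig_mem : ∀ t, 1 ≤ t → ∀ ω, sighat t ω ∈ Set.Icc (0:ℝ) 1)
    (hlam_pred : ∀ t, 1 ≤ t → StronglyMeasurable[ℱ (t - 1)] (lam t))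
    (hlam_mem : ∀ t, 1 ≤ t → ∀ ω, lam t ω ∈ Set.Ico (0:ℝ) 1)
    (hlam_pos : ∀ ω, 0 < lam 1 ω) :
    P {ω | ∃ t, 1 ≤ t ∧
        Dproc lam X muhat t ω + Rproc lam X muhat sighat α t ω ≤ σ2}
      ≤ ENNReal.ofReal α := by
  obtain ⟨hα0, hα1⟩ := hα
  let Y : ℕ → Ω → ℝ := fun t ω => max 0 (min 1 (X t ω))
  have hYm : ∀ t, Measurable[ℱ t] (Y t) := fun t =>
    measurable_const.max (measurable_const.min (hadapt t))
  have hY01 : ∀ t ω, Y t ω ∈ Set.Icc (0:ℝ) 1 := fun t ω =>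
    ⟨le_max_left _ _, max_le zero_le_one (min_le_left _ _)⟩
  have hYX : ∀ t, 1 ≤ t → Y t =ᵐ[P] X t := by
    intro t ht
    filter_upwards [hbdd t ht] with ω hω
    simp only [Y]
    rw [min_eq_right hω.2, max_eq_right hω.1]
  let G : ℕ → Ω → ℝ := fun n ω =>
    Real.exp (lam (n + 1) ω * (σ2 - sighat (n + 1) ω ^ 2)) *
      (1 + lam (n + 1) ω * (sighat (n + 1) ω ^ 2 - (Y (n + 1) ω - muhat (n + 1) ω) ^ 2))
  have hsq : ∀ n ω, -1 ≤ sighat (n + 1) ω ^ 2 - (Y (n + 1) ω - muhat (n + 1) ω) ^ 2 ∧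
      sighat (n + 1) ω ^ 2 - (Y (n + 1) ω - muhat (n + 1) ω) ^ 2 ≤ 1 := by
    intro n ω
    obtain ⟨a1, a2⟩ := hY01 (n + 1) ω
    obtain ⟨b1, b2⟩ := hmu_mem (n + 1) (by omega) ω
    obtain ⟨c1, c2⟩ := hsig_mem (n + 1) (by omega) ω
    constructor <;> nlinarith [sq_nonneg (Y (n + 1) ω - muhat (n + 1) ω)]
  have hfac : ∀ n ω, 0 ≤ 1 + lam (n + 1) ω *
        (sighat (n + 1) ω ^ 2 - (Y (n + 1) ω - muhat (n + 1) ω) ^ 2) ∧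
      1 + lam (n + 1) ω *
        (sighat (n + 1) ω ^ 2 - (Y (n + 1) ω - muhat (n + 1) ω) ^ 2) ≤ 2 := by
    intro n ω
    obtain ⟨a1, a2⟩ := hsq n ω
    obtain ⟨b1, b2⟩ := hlam_mem (n + 1) (by omega) ω
    constructor <;> nlinarith
  have hexpB : ∀ n ω, Real.exp (lam (n + 1) ω * (σ2 - sighat (n + 1) ω ^ 2))
      ≤ Real.exp |σ2| := by
    intro n ω
    obtain ⟨b1, b2⟩ := hlam_mem (n + 1) (by omega) ω
    apply Real.exp_le_exp.2
    nlinarith [abs_nonneg σ2, mul_nonneg b1 (sq_nonneg (sighat (n + 1) ω)),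
      mul_nonneg b1 (sub_nonneg.2 (le_abs_self σ2))]
  have hG0 : ∀ n ω, 0 ≤ G n ω := fun n ω => mul_nonneg (Real.exp_pos _).le (hfac n ω).1
  have hville := aux_ville P ℱ G (Real.exp |σ2| * 2) (1 / α)
    (by nlinarith [Real.add_one_le_exp |σ2|, abs_nonneg σ2]) (by positivity)
    (by
      intro n
      have hle : ℱ n ≤ ℱ (n + 1) := ℱ.mono n.le_succ
      have h1 : Measurable[ℱ (n + 1)] (lam (n + 1)) :=
        (hlam_pred (n + 1) (by omega)).measurable.mono hle le_rfl
      have h2 : Measurable[ℱ (n + 1)] (sighat (n + 1)) :=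
        (hsig_pred (n + 1) (by omega)).measurable.mono hle le_rfl
      have h3 : Measurable[ℱ (n + 1)] (muhat (n + 1)) :=
        (hmu_pred (n + 1) (by omega)).measurable.mono hle le_rfl
      exact (Real.measurable_exp.comp (h1.mul (measurable_const.sub (h2.pow_const 2)))).mul
        (measurable_const.add (h1.mul ((h2.pow_const 2).sub
          (((hYm (n + 1)).sub h3).pow_const 2)))))
    hG0
    (fun n ω => mul_le_mul (hexpB n ω) (hfac n ω).2 (hfac n ω).1 (Real.exp_pos _).le)
    (by
      intro n
      have hn : 1 ≤ n + 1 := by omega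
      apply aux_condExp (ℱ.le n) P (Y (n + 1)) (muhat (n + 1)) (sighat (n + 1)) (lam (n + 1)) μ σ2
        ((hYm (n + 1)).mono (ℱ.le _) le_rfl) (hY01 (n + 1))
      · exact (condExp_congr_ae (hYX (n + 1) hn)).trans (hmean (n + 1) hn)
      · refine (condExp_congr_ae ?_).trans (hvar (n + 1) hn)
        filter_upwards [hYX (n + 1) hn] with ω hω
        rw [hω]
      · exact (hmu_pred (n + 1) hn).measurable
      · exact hmu_mem (n + 1) hn
      · exact (hsig_pred (n + 1) hn).measurable
      · exact hsig_mem (n + 1) hn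
      · exact (hlam_pred (n + 1) hn).measurable
      · exact hlam_mem (n + 1) hn)
  rw [one_div_one_div] at hville
  refine le_trans (measure_mono_ae ?_) hville
  have hall : ∀ᵐ ω ∂P, ∀ n, Y (n + 1) ω = X (n + 1) ω :=
    ae_all_iff.2 fun n => hYX (n + 1) (by omega)
  filter_upwards [hall] with ω hω
  rintro ⟨t, ht, hle⟩
  refine ⟨t, ?_⟩
  have hL : 0 < ∑ i ∈ Finset.Icc 1 t, lam i ω := by
    apply Finset.sum_pos'
    · intro i hi
      exact (hlam_mem i (Finset.mem_Icc.1 hi).1 ω).1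
    · exact ⟨1, Finset.mem_Icc.2 ⟨le_rfl, ht⟩, hlam_pos ω⟩
  rw [Dproc, Rproc, ← add_div, div_le_iff₀ hL] at hle
  rw [aux_sum, aux_sum, aux_sum] at hle
  have hGe : ∀ n, Real.exp (lam (n + 1) ω * σ2 - lam (n + 1) ω * (X (n + 1) ω - muhat (n + 1) ω) ^ 2
      - psiE (lam (n + 1) ω) * ((X (n + 1) ω - muhat (n + 1) ω) ^ 2 - sighat (n + 1) ω ^ 2) ^ 2)
      ≤ G n ω := by
    intro n
    have h := aux_fan (hsq n ω).1 (hlam_mem (n + 1) (by omega) ω).1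
      (hlam_mem (n + 1) (by omega) ω).2
    refine le_trans (le_of_eq ?_) (mul_le_mul_of_nonneg_left h (Real.exp_pos _).le)
    rw [← Real.exp_add, hω n]
    congr 1; ring
  refine le_trans ?_ (Finset.prod_le_prod (fun i _ => (Real.exp_pos _).le) fun i _ => hGe i)
  rw [← Real.exp_sum, ← Real.log_le_iff_le_exp (by positivity), Finset.sum_sub_distrib,
    Finset.sum_sub_distrib, ← Finset.sum_mul]
  linarith
end
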